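/- arXiv:0706.3837 — 3 statements merged into one kernel-verified Lean document; each statement's English description precedes it below -/
import Mathlib

section
/- Assume τ is additionally an involution (τ² = id). Set Q^− = (1/4)(g⊠g − ω⊠ω + A⊠A − B⊠B), I^ℂ₀ = (1/8)(g⊠g + ω⊠ω − (2/d)·ω⊙ω), T₀ = (1/8)(A⊠A + B⊠B + (2/d)·ω⊙ω), and Q₀^+ = (1/2)(I^ℂ₀ − T₀). Then c(Q^−) = (d−1)·g, tr (Q^−)̂ = d(d−1), c(Q₀^+) = ((d−1)(d+2)/(4d))·g, and tr (Q₀^+)̂ = (d−1)(d+2)/4. -/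
noncomputable section
open Finset RealInnerProductSpace

namespace Stmt

variable {V : Type*}

/-- The symmetric product `h⊙k` of two bilinear forms. -/
def symProd (h k : V → V → ℝ) : V → V → V → V → ℝ :=
  fun X Y Z W => h X Y * k Z W + h Z W * k X Y

/-- The Kulkarni product `h⊠k` of two bilinear forms. -/
def kulk (h k : V → V → ℝ) : V → V → V → V → ℝ :=
  fun X Y Z W => symProd h k X Z Y W - symProd h k X W Y Z

/-- The Bianchi map `b(Q)`. -/
def bianchi (Q : V → V → V → V → ℝ) : V → V → V → V → ℝ :=
  fun X Y Z W => Q X Y Z W + Q Z X Y W + Q Y Z X W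

/-- A 4-linear form is of curvature type if it is antisymmetric in its first two
arguments, antisymmetric in its last two arguments, and invariant under exchanging
the first pair with the second pair. -/
def CurvType (Q : V → V → V → V → ℝ) : Prop :=
  (∀ X Y Z W, Q Y X Z W = - Q X Y Z W) ∧
  (∀ X Y Z W, Q X Y W Z = - Q X Y Z W) ∧
  (∀ X Y Z W, Q Z W X Y = Q X Y Z W)

variable [NormedAddCommGroup V] [InnerProductSpace ℝ V]

/-- The inner product `g` as a bilinear form. -/
def gF : V → V → ℝ := fun X Y => ⟪X, Y⟫

/-- The fundamental 2-form `ω(X,Y) = ⟨JX,Y⟩`. -/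
def omF (J : V →ₗ[ℝ] V) : V → V → ℝ := fun X Y => ⟪J X, Y⟫

/-- The torsion form `A(X,Y) = ⟨τX,Y⟩`. -/
def aF (τ : V →ₗ[ℝ] V) : V → V → ℝ := fun X Y => ⟪τ X, Y⟫

/-- The form `B(X,Y) = ⟨JτX,Y⟩`. -/
def bF (J τ : V →ₗ[ℝ] V) : V → V → ℝ := fun X Y => ⟪J (τ X), Y⟫

/-- The J-invariant part `Q^+` of a 4-linear form. -/
def qPlus (J : V →ₗ[ℝ] V) (Q : V → V → V → V → ℝ) : V → V → V → V → ℝ :=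
  fun X Y Z W => (1/4) * (Q X Y Z W + Q (J X) (J Y) Z W + Q X Y (J Z) (J W)
    + Q (J X) (J Y) (J Z) (J W))

/-- The J-anti-invariant part `Q^-` of a 4-linear form. -/
def qMinus (J : V →ₗ[ℝ] V) (Q : V → V → V → V → ℝ) : V → V → V → V → ℝ :=
  fun X Y Z W => (1/4) * (Q X Y Z W - Q (J X) (J Y) Z W - Q X Y (J Z) (J W)
    + Q (J X) (J Y) (J Z) (J W))

/-- `tr Q̂ = (1/2)·Σ_{i,j} Q(e_i,e_j,e_i,e_j)`. -/
def trHat {n : ℕ} (e : OrthonormalBasis (Fin n) ℝ V) (Q : V → V → V → V → ℝ) : ℝ :=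
  (1/2) * ∑ i, ∑ j, Q (e i) (e j) (e i) (e j)

/-- The Ricci contraction `c(Q)(X,Y) = Σ_i Q(e_i,X,e_i,Y)`. -/
def ricciC {n : ℕ} (e : OrthonormalBasis (Fin n) ℝ V) (Q : V → V → V → V → ℝ) :
    V → V → ℝ :=
  fun X Y => ∑ i, Q (e i) X (e i) Y

/-- The endomorphism `Q̂` of `Λ²V`, acting on antisymmetric bilinear forms by
`(Q̂γ)(X,Y) = (1/2)·Σ_{i,j} Q(e_i,e_j,X,Y)·γ(e_i,e_j)`. -/
def hatOp {n : ℕ} (e : OrthonormalBasis (Fin n) ℝ V) (Q : V → V → V → V → ℝ)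
    (γ : V → V → ℝ) : V → V → ℝ :=
  fun X Y => (1/2) * ∑ i, ∑ j, Q (e i) (e j) X Y * γ (e i) (e j)

/-- The 4-linear form corresponding to the composition `P̂∘Q̂`. -/
def hatComp {n : ℕ} (e : OrthonormalBasis (Fin n) ℝ V) (P Q : V → V → V → V → ℝ) :
    V → V → V → V → ℝ :=
  fun X Y Z W => (1/2) * ∑ k, ∑ l, Q X Y (e k) (e l) * P (e k) (e l) Z W

/-- The scalar product `⟨P,Q⟩ = (1/2)·tr(P̂∘Q̂)` of curvature-type forms. -/
def formInner {n : ℕ} (e : OrthonormalBasis (Fin n) ℝ V) (P Q : V → V → V → V → ℝ) : ℝ :=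
  (1/2) * trHat e (hatComp e P Q)

/-- The trace of an endomorphism that anticommutes with a complex structure vanishes. -/
theorem sum_inner_eq_zero_of_anticomm {n : ℕ} (e : OrthonormalBasis (Fin n) ℝ V)
    {J S : V →ₗ[ℝ] V} (hJ2 : ∀ X : V, J (J X) = -X) (hSJ : ∀ X : V, S (J X) = -J (S X)) :
    ∑ i, ⟪S (e i), e i⟫ = 0 := by
  have htr : LinearMap.trace ℝ V S = -LinearMap.trace ℝ V S := by
    calc LinearMap.trace ℝ V S = LinearMap.trace ℝ V (J * (S * J)) := by
          congr 1
          ext X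
          simp [hSJ, hJ2]
      _ = LinearMap.trace ℝ V (S * J * J) := LinearMap.trace_mul_comm ℝ _ _
      _ = LinearMap.trace ℝ V (-S) := by
          congr 1
          ext X
          simp [hJ2]
      _ = -LinearMap.trace ℝ V S := map_neg _ _
  have hsum := LinearMap.trace_eq_sum_inner S e
  simp only [real_inner_comm] at hsum ⊢
  linarith

/-- The Ricci contraction of `h ⊠ h` for `h(X,Y) = ⟨SX,Y⟩`, where `S` is an isometry that is
symmetric (`ε = 1`) or skew (`ε = -1`). -/
theorem ricciC_kulk_self {n : ℕ} (e : OrthonormalBasis (Fin n) ℝ V) {S : V →ₗ[ℝ] V} {ε : ℝ}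
    (hS : ∀ X Y : V, ⟪S X, Y⟫ = ε * ⟪X, S Y⟫) (hO : ∀ X Y : V, ⟪S X, S Y⟫ = ⟪X, Y⟫) (X Y : V) :
    ricciC e (kulk (aF S) (aF S)) X Y
      = 2 * ((∑ i, ⟪S (e i), e i⟫) * ⟪S X, Y⟫ - ε * ⟪X, Y⟫) := by
  have hsum := e.sum_inner_mul_inner (S X) (S Y)
  rw [hO] at hsum
  rw [← hsum, Finset.mul_sum, Finset.sum_mul, ← Finset.sum_sub_distrib, Finset.mul_sum]
  refine Finset.sum_congr rfl fun i _ => ?_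
  simp only [kulk, symProd, aF, hS (e i) Y]
  ring

/-- The Ricci contraction of `ω ⊙ ω`. -/
theorem ricciC_symProd_omF {n : ℕ} (e : OrthonormalBasis (Fin n) ℝ V) {J : V →ₗ[ℝ] V}
    (hJs : ∀ X Y : V, ⟪J X, Y⟫ = -1 * ⟪X, J Y⟫) (hJO : ∀ X Y : V, ⟪J X, J Y⟫ = ⟪X, Y⟫)
    (X Y : V) :
    ricciC e (symProd (omF J) (omF J)) X Y = 2 * ⟪X, Y⟫ := by
  have hsum := e.sum_inner_mul_inner (J X) (J Y)
  rw [hJO] at hsum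
  rw [← hsum, Finset.mul_sum]
  refine Finset.sum_congr rfl fun i _ => ?_
  simp only [symProd, omF, hJs (e i), real_inner_comm (e i) (J X)]
  ring

/-- A form whose Ricci contraction is `c · g` has trace `(n / 2) c`. -/
theorem trHat_eq_of_ricciC_eq {n : ℕ} (e : OrthonormalBasis (Fin n) ℝ V)
    {Q : V → V → V → V → ℝ} {c : ℝ} (h : ∀ X Y : V, ricciC e Q X Y = c * ⟪X, Y⟫) :
    trHat e Q = n / 2 * c := by
  have hsum : ∑ j, ∑ i, Q (e i) (e j) (e i) (e j) = ∑ j : Fin n, c :=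
    Finset.sum_congr rfl fun j _ => by simpa [ricciC] using h (e j) (e j)
  rw [trHat, Finset.sum_comm, hsum]
  simp
  ring

theorem stmt16 [NormedAddCommGroup V] [InnerProductSpace ℝ V]
    {d : ℕ} (hd : 1 ≤ d) (e : OrthonormalBasis (Fin (2*d)) ℝ V)
    (J : V →ₗ[ℝ] V) (hJ2 : ∀ X : V, J (J X) = -X)
    (hJO : ∀ X Y : V, ⟪J X, J Y⟫ = ⟪X, Y⟫)
    (τ : V →ₗ[ℝ] V) (hτs : ∀ X Y : V, ⟪τ X, Y⟫ = ⟪X, τ Y⟫)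
    (hτJ : ∀ X : V, τ (J X) = - J (τ X))
    (hτ2 : ∀ X : V, τ (τ X) = X) :
    (∀ X Y : V,
      ricciC e (fun a b c x =>
        (1/4) * (kulk gF gF a b c x - kulk (omF J) (omF J) a b c x
          + kulk (aF τ) (aF τ) a b c x - kulk (bF J τ) (bF J τ) a b c x)) X Y
        = ((d:ℝ) - 1) * ⟪X, Y⟫) ∧
    trHat e (fun a b c x =>
      (1/4) * (kulk gF gF a b c x - kulk (omF J) (omF J) a b c x
        + kulk (aF τ) (aF τ) a b c x - kulk (bF J τ) (bF J τ) a b c x))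
      = (d:ℝ) * ((d:ℝ) - 1) ∧
    (∀ X Y : V,
      ricciC e (fun a b c x =>
        (1/2) * ((1/8) * (kulk gF gF a b c x + kulk (omF J) (omF J) a b c x
            - (2/(d:ℝ)) * symProd (omF J) (omF J) a b c x)
          - (1/8) * (kulk (aF τ) (aF τ) a b c x + kulk (bF J τ) (bF J τ) a b c x
            + (2/(d:ℝ)) * symProd (omF J) (omF J) a b c x))) X Y
        = (((d:ℝ) - 1) * ((d:ℝ) + 2) / (4*(d:ℝ))) * ⟪X, Y⟫) ∧
    trHat e (fun a b c x =>
      (1/2) * ((1/8) * (kulk gF gF a b c x + kulk (omF J) (omF J) a b c x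
          - (2/(d:ℝ)) * symProd (omF J) (omF J) a b c x)
        - (1/8) * (kulk (aF τ) (aF τ) a b c x + kulk (bF J τ) (bF J τ) a b c x
          + (2/(d:ℝ)) * symProd (omF J) (omF J) a b c x)))
      = ((d:ℝ) - 1) * ((d:ℝ) + 2) / 4 := by
  have hJs : ∀ X Y : V, ⟪J X, Y⟫ = -1 * ⟪X, J Y⟫ := fun X Y => by
    have h := hJO X (J Y)
    rw [hJ2, inner_neg_right] at h
    linarith
  have hτs' : ∀ X Y : V, ⟪τ X, Y⟫ = 1 * ⟪X, τ Y⟫ := fun X Y => by rw [hτs, one_mul]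
  have hτO : ∀ X Y : V, ⟪τ X, τ Y⟫ = ⟪X, Y⟫ := fun X Y => by rw [hτs, hτ2]
  have hBs : ∀ X Y : V, ⟪(J ∘ₗ τ) X, Y⟫ = 1 * ⟪X, (J ∘ₗ τ) Y⟫ := fun X Y => by
    simp only [LinearMap.comp_apply]
    rw [hJs, hτs, hτJ, inner_neg_right]
    ring
  have hBO : ∀ X Y : V, ⟪(J ∘ₗ τ) X, (J ∘ₗ τ) Y⟫ = ⟪X, Y⟫ := fun X Y => by
    simp only [LinearMap.comp_apply, hJO, hτO]
  have hBJ : ∀ X : V, (J ∘ₗ τ) (J X) = -J ((J ∘ₗ τ) X) := fun X => by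
    simp only [LinearMap.comp_apply, hτJ, map_neg]
  have hd0 : (d : ℝ) ≠ 0 := by exact_mod_cast (by lia : d ≠ 0)
  have hg : ∀ X Y : V, ricciC e (kulk gF gF) X Y = 2 * (2 * d - 1) * ⟪X, Y⟫ := fun X Y => by
    have h := ricciC_kulk_self e (S := LinearMap.id) (ε := 1) (by simp) (by simp) X Y
    simp only [LinearMap.id_apply, e.inner_eq_one, Finset.sum_const, Finset.card_univ,
      Fintype.card_fin, nsmul_eq_mul, Nat.cast_mul, Nat.cast_ofNat, mul_one, one_mul] at h
    exact h.trans (by ring)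
  have hω : ∀ X Y : V, ricciC e (kulk (omF J) (omF J)) X Y = 2 * ⟪X, Y⟫ := fun X Y => by
    have h0 : ∀ Z : V, ⟪J Z, Z⟫ = 0 := fun Z => by
      have h := hJs Z Z
      rw [real_inner_comm (J Z) Z] at h
      linarith
    have h := ricciC_kulk_self e hJs hJO X Y
    simp only [h0, Finset.sum_const_zero] at h
    exact h.trans (by ring)
  have hA : ∀ X Y : V, ricciC e (kulk (aF τ) (aF τ)) X Y = -2 * ⟪X, Y⟫ := fun X Y => by
    rw [ricciC_kulk_self e hτs' hτO, sum_inner_eq_zero_of_anticomm e hJ2 hτJ]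
    ring
  have hB : ∀ X Y : V, ricciC e (kulk (bF J τ) (bF J τ)) X Y = -2 * ⟪X, Y⟫ := fun X Y => by
    have h := ricciC_kulk_self e hBs hBO X Y
    rw [sum_inner_eq_zero_of_anticomm e hJ2 hBJ] at h
    exact h.trans (by ring)
  have hs := ricciC_symProd_omF e hJs hJO
  rw [← and_assoc]
  refine ⟨and_iff_left_of_imp (fun h => ?_) |>.2 fun X Y => ?_,
    and_iff_left_of_imp (fun h => ?_) |>.2 fun X Y => ?_⟩
  · rw [trHat_eq_of_ricciC_eq e h]
    push_cast
    ring
  · have h : ((d : ℝ) - 1) * ⟪X, Y⟫ = (1/4) * (ricciC e (kulk gF gF) X Y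
        - ricciC e (kulk (omF J) (omF J)) X Y + ricciC e (kulk (aF τ) (aF τ)) X Y
        - ricciC e (kulk (bF J τ) (bF J τ)) X Y) := by
      rw [hg, hω, hA, hB]
      ring
    rw [h]
    simp only [ricciC, Finset.mul_sum, ← Finset.sum_sub_distrib, ← Finset.sum_add_distrib]
  · rw [trHat_eq_of_ricciC_eq e h]
    push_cast
    field_simp
  · have h : ((d : ℝ) - 1) * ((d : ℝ) + 2) / (4 * (d : ℝ)) * ⟪X, Y⟫
        = (1/2) * ((1/8) * (ricciC e (kulk gF gF) X Y + ricciC e (kulk (omF J) (omF J)) X Y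
            - (2/(d:ℝ)) * ricciC e (symProd (omF J) (omF J)) X Y)
          - (1/8) * (ricciC e (kulk (aF τ) (aF τ)) X Y + ricciC e (kulk (bF J τ) (bF J τ)) X Y
            + (2/(d:ℝ)) * ricciC e (symProd (omF J) (omF J)) X Y)) := by
      rw [hg, hω, hA, hB, hs]
      field_simp
      ring
    rw [h]
    simp only [ricciC, Finset.mul_sum, ← Finset.sum_sub_distrib, ← Finset.sum_add_distrib]


end Stmt
end
end

section
/- With I^ℂ = (1/8)(g⊠g + ω⊠ω + 2·ω⊙ω) and I^ℂ₀ = (1/8)(g⊠g + ω⊠ω − (2/d)·ω⊙ω), one has tr (I^ℂ)̂ = d(d+1)/2 and tr (I^ℂ₀)̂ = (d² − 1)/2. -/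
noncomputable section
open Finset RealInnerProductSpace

namespace Stmt

variable {V : Type*}

variable [NormedAddCommGroup V] [InnerProductSpace ℝ V]

lemma omF_swap {J : V →ₗ[ℝ] V} (hJ2 : ∀ X : V, J (J X) = -X)
    (hJO : ∀ X Y : V, ⟪J X, J Y⟫ = ⟪X, Y⟫) (X Y : V) : omF J Y X = -omF J X Y := by
  simp only [omF]
  rw [← hJO (J Y) X, hJ2, inner_neg_left, real_inner_comm]

lemma omF_self {J : V →ₗ[ℝ] V} (hJ2 : ∀ X : V, J (J X) = -X)
    (hJO : ∀ X Y : V, ⟪J X, J Y⟫ = ⟪X, Y⟫) (X : V) : omF J X X = 0 := by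
  linarith [omF_swap hJ2 hJO X X]

lemma sum_omF_sq {n : ℕ} (e : OrthonormalBasis (Fin n) ℝ V) {J : V →ₗ[ℝ] V}
    (hJO : ∀ X Y : V, ⟪J X, J Y⟫ = ⟪X, Y⟫) :
    ∑ i, ∑ j, omF J (e i) (e j) ^ 2 = n := by
  have h (i : Fin n) : ∑ j, omF J (e i) (e j) ^ 2 = 1 := by
    rw [← e.inner_eq_one i, ← hJO (e i) (e i), ← e.sum_inner_mul_inner]
    refine Finset.sum_congr rfl fun j _ => ?_
    rw [omF, sq, real_inner_comm (J (e i)) (e j)]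
  simp [h]

lemma sum_gF_sq {n : ℕ} (e : OrthonormalBasis (Fin n) ℝ V) :
    ∑ i, ∑ j, gF (e i) (e j) ^ 2 = n := by
  simp [gF, e.inner_eq_ite]

/-- The trace of a combination of `g⊠g + ω⊠ω` and `ω⊙ω`. -/
lemma trHat_kulk_add_symProd {n : ℕ} (e : OrthonormalBasis (Fin n) ℝ V) {J : V →ₗ[ℝ] V}
    (hJ2 : ∀ X : V, J (J X) = -X) (hJO : ∀ X Y : V, ⟪J X, J Y⟫ = ⟪X, Y⟫) (t : ℝ) :
    trHat e (fun a b c x =>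
      (1/8) * (kulk gF gF a b c x + kulk (omF J) (omF J) a b c x
        + t * symProd (omF J) (omF J) a b c x))
      = (n : ℝ) * (n + t) / 8 := by
  have h (i j : Fin n) :
      (1/8) * (kulk gF gF (e i) (e j) (e i) (e j)
        + kulk (omF J) (omF J) (e i) (e j) (e i) (e j)
        + t * symProd (omF J) (omF J) (e i) (e j) (e i) (e j))
      = 1/4 - (1/4) * gF (e i) (e j) ^ 2 + ((1 + t)/4) * omF J (e i) (e j) ^ 2 := by
    have hg (k : Fin n) : gF (e k) (e k) = 1 := e.inner_eq_one k
    have hs : gF (e j) (e i) = gF (e i) (e j) := real_inner_comm _ _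
    simp only [kulk, symProd, hg, hs, omF_self hJ2 hJO, omF_swap hJ2 hJO (e i) (e j)]
    ring
  simp only [trHat, h, Finset.sum_add_distrib, Finset.sum_sub_distrib, ← Finset.mul_sum,
    sum_gF_sq, sum_omF_sq e hJO]
  simp
  ring

theorem stmt17 [NormedAddCommGroup V] [InnerProductSpace ℝ V]
    {d : ℕ} (hd : 1 ≤ d) (e : OrthonormalBasis (Fin (2*d)) ℝ V)
    (J : V →ₗ[ℝ] V) (hJ2 : ∀ X : V, J (J X) = -X)
    (hJO : ∀ X Y : V, ⟪J X, J Y⟫ = ⟪X, Y⟫) :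
    trHat e (fun a b c x =>
      (1/8) * (kulk gF gF a b c x + kulk (omF J) (omF J) a b c x
        + 2 * symProd (omF J) (omF J) a b c x))
      = (d:ℝ) * ((d:ℝ) + 1) / 2 ∧
    trHat e (fun a b c x =>
      (1/8) * (kulk gF gF a b c x + kulk (omF J) (omF J) a b c x
        - (2/(d:ℝ)) * symProd (omF J) (omF J) a b c x))
      = ((d:ℝ)^2 - 1) / 2 := by
  have hd0 : (d : ℝ) ≠ 0 := by positivity
  constructor
  · rw [trHat_kulk_add_symProd e hJ2 hJO]
    push_cast
    ring
  · simp only [sub_eq_add_neg, ← neg_mul]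
    rw [trHat_kulk_add_symProd e hJ2 hJO]
    push_cast
    field_simp
    ring

end Stmt
end
end

section
/- Assume τ is additionally an involution (τ² = id). For a 4-linear form Q define its τ-invariant part Q₊(X,Y,Z,W) = (1/4)(Q(X,Y,Z,W) + Q(τX,τY,Z,W) + Q(X,Y,τZ,τW) + Q(τX,τY,τZ,τW)). Then, with I^ℂ = (1/8)(g⊠g + ω⊠ω + 2·ω⊙ω), one has (I^ℂ)₊ = (1/16)(g⊠g + A⊠A + ω⊠ω + B⊠B) and tr ((I^ℂ)₊)̂ = d(d−1)/4. -/
noncomputable section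
open Finset RealInnerProductSpace

namespace Stmt

variable {V : Type*}

variable [NormedAddCommGroup V] [InnerProductSpace ℝ V]

/-- The `τ`-invariant part `Q₊` of a 4-linear form. -/
def tauPart (τ : V →ₗ[ℝ] V) (Q : V → V → V → V → ℝ) : V → V → V → V → ℝ :=
  fun X Y Z W => (1/4) * (Q X Y Z W + Q (τ X) (τ Y) Z W + Q X Y (τ Z) (τ W)
    + Q (τ X) (τ Y) (τ Z) (τ W))

/-- The scalar contraction of `h ⊠ h` for the bilinear form `h` of an endomorphism `T`. -/
lemma sum_kulk_aF {n : ℕ} (e : OrthonormalBasis (Fin n) ℝ V) (T : V →ₗ[ℝ] V) :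
    ∑ i, ∑ j, kulk (aF T) (aF T) (e i) (e j) (e i) (e j)
      = 2 * LinearMap.trace ℝ V T ^ 2 - 2 * LinearMap.trace ℝ V (T ∘ₗ T) := by
  have hsq : ∀ i, ∑ j, ⟪T (e i), e j⟫ * ⟪T (e j), e i⟫ = ⟪T (T (e i)), e i⟫ := by
    intro i
    conv_rhs => rw [← e.sum_repr' (T (e i))]
    simp only [map_sum, map_smul, sum_inner, real_inner_smul_left]
    exact Finset.sum_congr rfl fun j _ => by rw [real_inner_comm]
  simp only [T.trace_eq_sum_inner e, (T ∘ₗ T).trace_eq_sum_inner e, LinearMap.comp_apply]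
  have htr : ∀ S : V →ₗ[ℝ] V, ∑ i, ⟪e i, S (e i)⟫ = ∑ i, ⟪S (e i), e i⟫ :=
    fun S => Finset.sum_congr rfl fun i _ => real_inner_comm _ _
  have htr2 := htr (T ∘ₗ T)
  simp only [LinearMap.comp_apply] at htr2
  rw [htr, htr2, pow_two, Finset.sum_mul_sum, Finset.mul_sum, Finset.mul_sum,
    ← Finset.sum_sub_distrib]
  refine Finset.sum_congr rfl fun i _ => ?_
  rw [← hsq, Finset.mul_sum, Finset.mul_sum, ← Finset.sum_sub_distrib]
  refine Finset.sum_congr rfl fun j _ => ?_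
  simp only [kulk, symProd, aF]
  ring

/-- An endomorphism anticommuting with a complex structure is trace-free. -/
lemma trace_eq_zero_of_anticomm [FiniteDimensional ℝ V] (J T : V →ₗ[ℝ] V) (hJ2 : ∀ X : V, J (J X) = -X)
    (hTJ : ∀ X : V, T (J X) = -J (T X)) :
    LinearMap.trace ℝ V T = 0 := by
  have h₁ : (T ∘ₗ J) ∘ₗ J = -T := by
    ext X
    simp [hJ2]
  have h₂ : J ∘ₗ (T ∘ₗ J) = T := by
    ext X
    simp [hTJ, hJ2]
  have h := LinearMap.trace_comp_comm' J (T ∘ₗ J)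
  rw [h₁, h₂, map_neg] at h
  linarith

/-- An orthogonal complex structure is trace-free. -/
lemma trace_eq_zero_of_orthogonal {n : ℕ} (e : OrthonormalBasis (Fin n) ℝ V) (J : V →ₗ[ℝ] V)
    (hJ2 : ∀ X : V, J (J X) = -X) (hJO : ∀ X Y : V, ⟪J X, J Y⟫ = ⟪X, Y⟫) :
    LinearMap.trace ℝ V J = 0 := by
  rw [J.trace_eq_sum_inner e]
  refine Finset.sum_eq_zero fun i _ => ?_
  have h := hJO (e i) (J (e i))
  rw [hJ2, inner_neg_right, real_inner_comm] at h
  linarith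

/-- The `τ`-invariant part of the constant holomorphic curvature form. -/
lemma tauPart_complexForm (J τ : V →ₗ[ℝ] V) (hτs : ∀ X Y : V, ⟪τ X, Y⟫ = ⟪X, τ Y⟫)
    (hτJ : ∀ X : V, τ (J X) = -J (τ X)) (hτ2 : ∀ X : V, τ (τ X) = X) (X Y Z W : V) :
    tauPart τ (fun a b c x =>
        (1/8) * (kulk gF gF a b c x + kulk (omF J) (omF J) a b c x
          + 2 * symProd (omF J) (omF J) a b c x)) X Y Z W
      = (1/16) * (kulk gF gF X Y Z W + kulk (aF τ) (aF τ) X Y Z W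
          + kulk (omF J) (omF J) X Y Z W + kulk (bF J τ) (bF J τ) X Y Z W) := by
  have hg : ∀ a b : V, ⟪a, τ b⟫ = ⟪τ a, b⟫ := fun a b => (hτs a b).symm
  simp only [tauPart, kulk, symProd, gF, omF, aF, bF, hg, hτ2, hτJ, inner_neg_left]
  ring

theorem stmt18 [NormedAddCommGroup V] [InnerProductSpace ℝ V]
    {d : ℕ} (hd : 1 ≤ d) (e : OrthonormalBasis (Fin (2*d)) ℝ V)
    (J : V →ₗ[ℝ] V) (hJ2 : ∀ X : V, J (J X) = -X)
    (hJO : ∀ X Y : V, ⟪J X, J Y⟫ = ⟪X, Y⟫)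
    (τ : V →ₗ[ℝ] V) (hτs : ∀ X Y : V, ⟪τ X, Y⟫ = ⟪X, τ Y⟫)
    (hτJ : ∀ X : V, τ (J X) = - J (τ X))
    (hτ2 : ∀ X : V, τ (τ X) = X) :
    (∀ X Y Z W : V,
      tauPart τ (fun a b c x =>
        (1/8) * (kulk gF gF a b c x + kulk (omF J) (omF J) a b c x
          + 2 * symProd (omF J) (omF J) a b c x)) X Y Z W
        = (1/16) * (kulk gF gF X Y Z W + kulk (aF τ) (aF τ) X Y Z W
            + kulk (omF J) (omF J) X Y Z W + kulk (bF J τ) (bF J τ) X Y Z W)) ∧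
    trHat e (tauPart τ (fun a b c x =>
      (1/8) * (kulk gF gF a b c x + kulk (omF J) (omF J) a b c x
        + 2 * symProd (omF J) (omF J) a b c x)))
      = (d:ℝ) * ((d:ℝ) - 1) / 4 := by
  refine ⟨tauPart_complexForm J τ hτs hτJ hτ2, ?_⟩
  simp only [trHat, tauPart_complexForm J τ hτs hτJ hτ2, ← Finset.mul_sum,
    Finset.sum_add_distrib]
  have : FiniteDimensional ℝ V := e.toBasis.finiteDimensional_of_finite
  have hid : LinearMap.trace ℝ V LinearMap.id = 2 * d := by
    rw [LinearMap.trace_id, Module.finrank_eq_card_basis e.toBasis]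
    simp
  have hττ : τ ∘ₗ τ = LinearMap.id := LinearMap.ext hτ2
  have hJJ : J ∘ₗ J = -LinearMap.id := LinearMap.ext hJ2
  have hBB : (J ∘ₗ τ) ∘ₗ (J ∘ₗ τ) = LinearMap.id := by
    ext X
    simp [hτJ, hτ2, hJ2]
  have hg := sum_kulk_aF e LinearMap.id
  have hA := sum_kulk_aF e τ
  have hω := sum_kulk_aF e J
  have hB := sum_kulk_aF e (J ∘ₗ τ)
  rw [LinearMap.id_comp, hid] at hg
  rw [hττ, hid, trace_eq_zero_of_anticomm J τ hJ2 hτJ] at hA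
  rw [hJJ, map_neg, hid, trace_eq_zero_of_orthogonal e J hJ2 hJO] at hω
  rw [hBB, hid, trace_eq_zero_of_anticomm J (J ∘ₗ τ) hJ2 (by simp [hτJ])] at hB
  change ∑ i, ∑ j, kulk gF gF (e i) (e j) (e i) (e j) = _ at hg
  change ∑ i, ∑ j, kulk (omF J) (omF J) (e i) (e j) (e i) (e j) = _ at hω
  change ∑ i, ∑ j, kulk (bF J τ) (bF J τ) (e i) (e j) (e i) (e j) = _ at hB
  rw [hg, hA, hω, hB]
  ring

end Stmt
end
end
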